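/- arXiv:2310.13983 — 2 statements merged into one kernel-verified Lean document; each statement's English description precedes it below -/
import Mathlib

section
/- For every integer d ≥ 2, every n ≥ 1, and every x ∈ Δ_{d−1}, the multinomial random vector satisfies 𝔼[‖G_n(x) − x‖⁴] ≤ 3d²/(16n²), where ‖·‖ is the Euclidean norm on ℝ^d. -/
open Finset

noncomputable section

/-- Multi-indices `k : Fin d → ℕ` with `|k| = k₁ + ⋯ + k_d = n`. -/
def multiIdx (d n : ℕ) : Finset (Fin d → ℕ) :=
  (Fintype.piFinset fun _ : Fin d => Finset.range (n + 1)).filter fun k => ∑ i, k i = n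

/-- Multinomial weight `n!/(k₁!⋯k_d!) · x₁^{k₁}⋯x_d^{k_d}`. -/
def mWeight {d : ℕ} (x : Fin d → ℝ) (k : Fin d → ℕ) : ℝ :=
  (Nat.multinomial Finset.univ k : ℝ) * ∏ i, x i ^ k i

/-- The Euclidean norm on `Fin d → ℝ`. -/
def eucNorm {d : ℕ} (v : Fin d → ℝ) : ℝ := Real.sqrt (∑ i, v i ^ 2)

lemma aux_c2 (k : ℕ) : (k.choose 2 : ℝ) = k * (k - 1) / 2 := by
  induction k with
  | zero => simp
  | succ k ih => rw [Nat.choose_succ_succ' k 1]; push_cast; rw [ih]; simp; ring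

lemma aux_c3 (k : ℕ) : (k.choose 3 : ℝ) = k * (k - 1) * (k - 2) / 6 := by
  induction k with
  | zero => simp
  | succ k ih => rw [Nat.choose_succ_succ' k 2]; push_cast; rw [ih, aux_c2]; ring

lemma aux_c4 (k : ℕ) : (k.choose 4 : ℝ) = k * (k - 1) * (k - 2) * (k - 3) / 24 := by
  induction k with
  | zero => simp
  | succ k ih => rw [Nat.choose_succ_succ' k 3]; push_cast; rw [ih, aux_c3]; ring

lemma multiIdx_eq (d n : ℕ) : multiIdx d n = Finset.piAntidiag Finset.univ n := by
  ext k
  simp only [multiIdx, Finset.mem_filter, Fintype.mem_piFinset, Finset.mem_range,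
    Finset.mem_piAntidiag]
  constructor
  · rintro ⟨_, h⟩
    exact ⟨h, fun i _ => Finset.mem_univ i⟩
  · rintro ⟨h, _⟩
    refine ⟨fun i => ?_, h⟩
    have := Finset.single_le_sum (f := k) (fun j _ => Nat.zero_le _) (Finset.mem_univ i)
    exact Nat.lt_succ_of_le (this.trans h.le)

lemma moment (d n : ℕ) (x : Fin d → ℝ) (hx : ∑ i, x i = 1) (i : Fin d) (j : ℕ) :
    ∑ k ∈ multiIdx d n, mWeight x k * ((k i).choose j : ℝ) = (n.choose j : ℝ) * x i ^ j := by
  have key := Finset.sum_pow_eq_sum_piAntidiag (Finset.univ : Finset (Fin d))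
    (fun l => Polynomial.C (x l) * (if l = i then (1 + Polynomial.X) else 1)) n
  have h1 : ∑ l, Polynomial.C (x l) * (if l = i then (1 + Polynomial.X) else 1)
      = ((1 + Polynomial.X : Polynomial ℝ)).comp (Polynomial.C (x i) * Polynomial.X) := by
    have : ∀ l, Polynomial.C (x l) * (if l = i then (1 + Polynomial.X) else 1)
      = Polynomial.C (x l) + (if l = i then Polynomial.C (x l) * Polynomial.X else 0) := by
      intro l; split_ifs <;> ring
    rw [Finset.sum_congr rfl (fun l _ => this l), Finset.sum_add_distrib, ← map_sum, hx]
    simp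
  rw [h1, ← Polynomial.pow_comp, ← multiIdx_eq] at key
  have key2 := congrArg (fun P => Polynomial.coeff P j) key
  simp only [Polynomial.comp_C_mul_X_coeff, Polynomial.coeff_one_add_X_pow,
    Polynomial.finsetSum_coeff] at key2
  rw [key2]
  refine Finset.sum_congr rfl fun k _ => ?_
  have h2 : (∏ l, (Polynomial.C (x l) * (if l = i then (1 + Polynomial.X) else 1)) ^ k l)
      = Polynomial.C (∏ l, x l ^ k l) * (1 + Polynomial.X) ^ k i := by
    simp only [mul_pow, Finset.prod_mul_distrib, map_prod, map_pow, ite_pow, one_pow]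
    simp
  rw [h2, ← Polynomial.C_eq_natCast, ← mul_assoc, ← Polynomial.C_mul, Polynomial.coeff_C_mul,
    Polynomial.coeff_one_add_X_pow]
  rfl

lemma fourth (d n : ℕ) (x : Fin d → ℝ) (hx : ∑ i, x i = 1) (i : Fin d) :
    ∑ k ∈ multiIdx d n, mWeight x k * ((k i : ℝ) - n * x i) ^ 4
      = n * (x i * (1 - x i)) * (1 + 3 * (n - 2) * (x i * (1 - x i))) := by
  have e : ∀ k : Fin d → ℕ, mWeight x k * ((k i : ℝ) - n * x i) ^ 4 =
      24 * (mWeight x k * ((k i).choose 4 : ℝ))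
      + (36 - 24 * (n * x i)) * (mWeight x k * ((k i).choose 3 : ℝ))
      + (14 - 24 * (n * x i) + 12 * (n * x i) ^ 2) * (mWeight x k * ((k i).choose 2 : ℝ))
      + (1 - 4 * (n * x i) + 6 * (n * x i) ^ 2 - 4 * (n * x i) ^ 3)
        * (mWeight x k * ((k i).choose 1 : ℝ))
      + (n * x i) ^ 4 * (mWeight x k * ((k i).choose 0 : ℝ)) := by
    intro k
    rw [aux_c4, aux_c3, aux_c2, Nat.choose_one_right, Nat.choose_zero_right]
    push_cast
    ring
  rw [Finset.sum_congr rfl fun k _ => e k]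
  simp only [Finset.sum_add_distrib, ← Finset.mul_sum, moment d n x hx i]
  rw [aux_c4, aux_c3, aux_c2, Nat.choose_one_right, Nat.choose_zero_right]
  push_cast
  ring

lemma fourth_le (d n : ℕ) (hn : 1 ≤ n) (x : Fin d → ℝ) (hx : x ∈ stdSimplex ℝ (Fin d))
    (i : Fin d) :
    ∑ k ∈ multiIdx d n, mWeight x k * ((k i : ℝ) / n - x i) ^ 4 ≤ 3 / (16 * (n : ℝ) ^ 2) := by
  have hn0 : (0 : ℝ) < n := by exact_mod_cast hn
  have e : ∀ k : Fin d → ℕ, mWeight x k * ((k i : ℝ) / n - x i) ^ 4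
      = (mWeight x k * ((k i : ℝ) - n * x i) ^ 4) / (n : ℝ) ^ 4 := by
    intro k; field_simp
  rw [Finset.sum_congr rfl fun k _ => e k, ← Finset.sum_div, fourth d n x hx.2 i,
    div_le_div_iff₀ (by positivity) (by positivity)]
  have h0 := hx.1 i
  have h1 : x i ≤ 1 := hx.2 ▸ Finset.single_le_sum (fun j _ => hx.1 j) (Finset.mem_univ i)
  have ht0 : 0 ≤ x i * (1 - x i) := mul_nonneg h0 (by linarith)
  have ht1 : x i * (1 - x i) ≤ 1 / 4 := by nlinarith [sq_nonneg (x i - 1 / 2)]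
  generalize x i * (1 - x i) = t at ht0 ht1
  have main : 16 * (t * (1 + 3 * (n - 2) * t)) ≤ 3 * n := by
    rcases Nat.lt_or_ge n 2 with h | h
    · have : n = 1 := by omega
      subst this
      norm_num
      nlinarith [sq_nonneg (t - 1 / 6)]
    · have h2 : (2 : ℝ) ≤ n := by exact_mod_cast h
      have ht2 : t * t ≤ 1 / 16 := by nlinarith
      nlinarith [mul_le_mul_of_nonneg_left ht2 (sub_nonneg.2 h2)]
  calc _ = (n : ℝ) ^ 3 * (16 * (t * (1 + 3 * (n - 2) * t))) := by ring
    _ ≤ (n : ℝ) ^ 3 * (3 * n) := by gcongr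
    _ = _ := by ring

lemma mWeight_nonneg {d : ℕ} (x : Fin d → ℝ) (hx : ∀ i, 0 ≤ x i) (k : Fin d → ℕ) :
    0 ≤ mWeight x k :=
  mul_nonneg (Nat.cast_nonneg _) (Finset.prod_nonneg fun i _ => pow_nonneg (hx i) _)

lemma eucNorm_four {d : ℕ} (v : Fin d → ℝ) : eucNorm v ^ 4 ≤ d * ∑ i, v i ^ 4 := by
  have h : eucNorm v ^ 4 = (∑ i, v i ^ 2) ^ 2 := by
    have := Real.sq_sqrt (Finset.sum_nonneg fun i (_ : i ∈ Finset.univ) => sq_nonneg (v i))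
    unfold eucNorm
    rw [show (4 : ℕ) = 2 * 2 from rfl, pow_mul, this]
  rw [h]
  have := sq_sum_le_card_mul_sum_sq (s := (Finset.univ : Finset (Fin d))) (f := fun i => v i ^ 2)
  simpa [← pow_mul] using this

/-- the multinomial random vector satisfies
`𝔼[‖G_n(x) − x‖⁴] ≤ 3d²/(16n²)`. -/
theorem multinomial_fourth_moment_bound (d : ℕ) (hd : 2 ≤ d) (n : ℕ) (hn : 1 ≤ n)
    (x : Fin d → ℝ) (hx : x ∈ stdSimplex ℝ (Fin d)) :
    ∑ k ∈ multiIdx d n,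
        mWeight x k * (eucNorm fun i => (k i : ℝ) / n - x i) ^ 4
      ≤ 3 * (d : ℝ) ^ 2 / (16 * (n : ℝ) ^ 2) := by
  calc _ ≤ ∑ k ∈ multiIdx d n, mWeight x k * (d * ∑ i, ((k i : ℝ) / n - x i) ^ 4) :=
        Finset.sum_le_sum fun k _ =>
          mul_le_mul_of_nonneg_left (eucNorm_four _) (mWeight_nonneg x hx.1 k)
    _ = d * ∑ i, ∑ k ∈ multiIdx d n, mWeight x k * ((k i : ℝ) / n - x i) ^ 4 := by
        rw [Finset.sum_comm, Finset.mul_sum]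
        refine Finset.sum_congr rfl fun k _ => ?_
        rw [← Finset.mul_sum]; ring
    _ ≤ d * ∑ i : Fin d, 3 / (16 * (n : ℝ) ^ 2) := by
        gcongr with i
        exact fourth_le d n hn x hx i
    _ = _ := by
        simp; ring
end
end

section
/- (Voronovskaya-type theorem with mutation.) Assume (Q1). Let f : ℝ^d → ℝ be twice continuously differentiable on an open neighborhood of Δ_{d−1}. Then lim_{n→∞} max_{x ∈ Δ_{d−1}} |n(B_{d,n}^{(q_n)} f(x) − f(x)) − 𝒜_d^{(q)} f(x)| = 0. -/
open Finset Filter MeasureTheory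

noncomputable section

/-- The `d`-dimensional Bernstein operator `B_{d,n}`. -/
def bernsteinOp (d n : ℕ) (f : (Fin d → ℝ) → ℝ) (x : Fin d → ℝ) : ℝ :=
  ∑ k ∈ multiIdx d n, mWeight x k * f fun i => (k i : ℝ) / n

/-- First partial derivative `∂f/∂x_i`. -/
def pd {d : ℕ} (i : Fin d) (f : (Fin d → ℝ) → ℝ) (x : Fin d → ℝ) : ℝ :=
  fderiv ℝ f x (Pi.single i 1)

/-- Second partial derivative `∂²f/∂x_i∂x_j`. -/
def pd2 {d : ℕ} (i j : Fin d) (f : (Fin d → ℝ) → ℝ) (x : Fin d → ℝ) : ℝ :=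
  pd i (pd j f) x

/-- The Wright–Fisher generator with mutation matrix `Q`:
`𝒜_d^{(q)} f(x) = (1/2) Σ_{i,j} x_i(δ_{ij} − x_j) ∂²f/∂x_i∂x_j (x)
  + Σ_i (Σ_j Q_{ji} x_j) ∂f/∂x_i (x)`. -/
def Adq (d : ℕ) (Q : Fin d → Fin d → ℝ) (f : (Fin d → ℝ) → ℝ) (x : Fin d → ℝ) : ℝ :=
  (1 / 2) * (∑ i, ∑ j, x i * ((if i = j then 1 else 0) - x j) * pd2 i j f x)
    + ∑ i, (∑ j, Q j i * x j) * pd i f x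

theorem mW_absorb {d n : ℕ} (y : Fin d → ℝ) (i : Fin d) (k : Fin d → ℕ) (hk : ∑ j, k j = n) :
    mWeight y (k + Pi.single i 1) * ((k i : ℝ) + 1) = (n + 1) * y i * mWeight y k := by
  have hadd : ∀ j, (k + Pi.single i 1 : Fin d → ℕ) j = if j = i then k i + 1 else k j := by
    intro j
    by_cases h : j = i
    · subst h; simp
    · simp [h]
  have h1 : ∏ j, ((k + Pi.single i 1 : Fin d → ℕ) j).factorial
      = (k i + 1) * ∏ j, (k j).factorial := by
    have : ∀ j, ((k + Pi.single i 1 : Fin d → ℕ) j).factorial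
        = (if j = i then (k i + 1) else 1) * (k j).factorial := by
      intro j; rw [hadd]
      by_cases h : j = i
      · subst h; simp [Nat.factorial_succ]
      · simp [h]
    simp_rw [this, Finset.prod_mul_distrib]
    simp
  have h2 : ∏ j, y j ^ ((k + Pi.single i 1 : Fin d → ℕ) j) = y i * ∏ j, y j ^ k j := by
    have : ∀ j, y j ^ ((k + Pi.single i 1 : Fin d → ℕ) j)
        = (if j = i then y i else 1) * y j ^ k j := by
      intro j; rw [hadd]
      by_cases h : j = i
      · subst h; simp [pow_succ, mul_comm]
      · simp [h]
    simp_rw [this, Finset.prod_mul_distrib]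
    simp
  have h3 : ∑ j, (k + Pi.single i 1 : Fin d → ℕ) j = n + 1 := by
    simp [Finset.sum_add_distrib, hk]
  have s1 := Nat.multinomial_spec Finset.univ (k + Pi.single i 1 : Fin d → ℕ)
  have s2 := Nat.multinomial_spec Finset.univ k
  rw [h1, h3, Nat.factorial_succ] at s1
  rw [hk] at s2
  rw [← s2] at s1
  have hpos : 0 < ∏ j, (k j).factorial := Finset.prod_pos fun j _ => Nat.factorial_pos _
  have s3 : (k i + 1) * Nat.multinomial Finset.univ (k + Pi.single i 1 : Fin d → ℕ)
      = (n + 1) * Nat.multinomial Finset.univ k := by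
    apply Nat.eq_of_mul_eq_mul_left hpos
    linarith
  have s4 : ((k i : ℝ) + 1) * (Nat.multinomial Finset.univ (k + Pi.single i 1 : Fin d → ℕ) : ℝ)
      = (n + 1) * (Nat.multinomial Finset.univ k : ℝ) := by exact_mod_cast s3
  unfold mWeight
  rw [h2]
  linear_combination (y i * ∏ j, y j ^ k j) * s4

theorem mem_multiIdx {d n : ℕ} (k : Fin d → ℕ) : k ∈ multiIdx d n ↔ ∑ i, k i = n := by
  unfold multiIdx
  simp only [Finset.mem_filter, Fintype.mem_piFinset, Finset.mem_range, and_iff_right_iff_imp]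
  intro h i
  have := Finset.single_le_sum (f := k) (fun _ _ => Nat.zero_le _) (Finset.mem_univ i)
  omega

theorem sum_absorb {d n : ℕ} (y : Fin d → ℝ) (i : Fin d) (g : (Fin d → ℕ) → ℝ) :
    ∑ k ∈ multiIdx d (n+1), mWeight y k * ((k i : ℝ) * g k)
      = (n + 1) * y i * ∑ k ∈ multiIdx d n, mWeight y k * g (k + Pi.single i 1) := by
  rw [Finset.mul_sum]
  symm
  apply Finset.sum_of_injOn (fun k => k + Pi.single i 1)
  · intro a _ b _ h
    exact add_right_cancel h
  · intro k hk
    rw [Finset.mem_coe, mem_multiIdx] at hk ⊢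
    simp [Finset.sum_add_distrib, hk]
  · intro k hk hk'
    by_cases h0 : k i = 0
    · simp [h0]
    · exfalso; apply hk'
      have hle : (Pi.single i 1 : Fin d → ℕ) ≤ k := by
        intro j
        by_cases h : j = i
        · subst h; simp; omega
        · simp [h]
      refine ⟨k - Pi.single i 1, ?_, tsub_add_cancel_of_le hle⟩
      rw [mem_multiIdx] at hk
      rw [Finset.mem_coe, mem_multiIdx]
      have h2 : ∑ j, ((k - Pi.single i 1 : Fin d → ℕ) + Pi.single i 1 : Fin d → ℕ) j = n + 1 := by
        rw [tsub_add_cancel_of_le hle]; exact hk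
      simp only [Pi.add_apply, Finset.sum_add_distrib, Finset.sum_pi_single', Finset.mem_univ,
        if_true] at h2
      omega
  · intro k hk
    rw [mem_multiIdx] at hk
    have := mW_absorb y i k hk
    simp only [Pi.add_apply, Pi.single_eq_same, Nat.cast_add, Nat.cast_one]
    linear_combination -(g (k + Pi.single i 1)) * this

theorem sum_rec {d n : ℕ} (y : Fin d → ℝ) (g : (Fin d → ℕ) → ℝ) :
    ∑ k ∈ multiIdx d (n+1), mWeight y k * g k
      = ∑ k ∈ multiIdx d n, mWeight y k * ∑ l, y l * g (k + Pi.single l 1) := by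
  have h : ((n : ℝ) + 1) * ∑ k ∈ multiIdx d (n+1), mWeight y k * g k
      = (n + 1) * ∑ k ∈ multiIdx d n, mWeight y k * ∑ l, y l * g (k + Pi.single l 1) := by
    calc _ = ∑ i, ∑ k ∈ multiIdx d (n+1), mWeight y k * ((k i : ℝ) * g k) := by
          rw [Finset.sum_comm, Finset.mul_sum]
          apply Finset.sum_congr rfl
          intro k hk
          rw [mem_multiIdx] at hk
          have : ∑ i, (k i : ℝ) = n + 1 := by exact_mod_cast hk
          rw [← Finset.mul_sum, ← Finset.sum_mul, this]; ring
      _ = _ := by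
          simp_rw [sum_absorb, Finset.mul_sum]
          rw [Finset.sum_comm]
          refine Finset.sum_congr rfl fun k _ => Finset.sum_congr rfl fun l _ => by ring
  exact mul_left_cancel₀ (by positivity) h

theorem mW_nonneg {d : ℕ} (y : Fin d → ℝ) (hy : ∀ i, 0 ≤ y i) (k : Fin d → ℕ) :
    0 ≤ mWeight y k :=
  mul_nonneg (Nat.cast_nonneg _) (Finset.prod_nonneg fun i _ => pow_nonneg (hy i) _)

theorem multiIdx_zero {d : ℕ} : multiIdx d 0 = {0} := by
  ext k
  rw [mem_multiIdx]
  simp [funext_iff]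

theorem mom0 {d : ℕ} (y : Fin d → ℝ) (hy : ∑ i, y i = 1) (n : ℕ) :
    ∑ k ∈ multiIdx d n, mWeight y k = 1 := by
  induction n with
  | zero => simp [multiIdx_zero, mWeight, Nat.multinomial]
  | succ n ih =>
    have := sum_rec (n := n) y (fun _ => 1)
    simpa [hy, ih] using this

theorem cen_step {d n : ℕ} (y : Fin d → ℝ) (k : Fin d → ℕ) (l i : Fin d) :
    (((k + Pi.single l 1 : Fin d → ℕ) i : ℕ) : ℝ) - ((n + 1 : ℕ) : ℝ) * y i
      = ((k i : ℝ) - n * y i) + ((if l = i then 1 else 0) - y i) := by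
  by_cases h : l = i
  · subst h; simp; ring
  · have h' : i ≠ l := fun e => h e.symm
    simp [h, h']; ring

theorem sum_ind {d : ℕ} (y : Fin d → ℝ) (hy : ∑ i, y i = 1) (i : Fin d) (F : ℝ → ℝ) :
    ∑ l, y l * F (if l = i then 1 else 0) = y i * F 1 + (1 - y i) * F 0 := by
  have : ∀ l, y l * F (if l = i then 1 else 0)
      = (if l = i then y l * (F 1 - F 0) else 0) + y l * F 0 := by
    intro l; split_ifs <;> ring
  simp_rw [this, Finset.sum_add_distrib, ← Finset.sum_mul, hy]
  simp; ring

theorem mom1 {d : ℕ} (y : Fin d → ℝ) (hy : ∑ i, y i = 1) (i : Fin d) (n : ℕ) :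
    ∑ k ∈ multiIdx d n, mWeight y k * ((k i : ℝ) - n * y i) = 0 := by
  induction n with
  | zero => simp [multiIdx_zero]
  | succ n ih =>
    rw [sum_rec y (fun k => (k i : ℝ) - ((n+1 : ℕ) : ℝ) * y i)]
    simp_rw [cen_step]
    refine Eq.trans (Finset.sum_congr rfl fun k _ => ?_) ih
    rw [sum_ind y hy i (fun t => (k i : ℝ) - n * y i + (t - y i))]
    ring

theorem mom2 {d : ℕ} (y : Fin d → ℝ) (hy : ∑ i, y i = 1) (i j : Fin d) (n : ℕ) :
    ∑ k ∈ multiIdx d n, mWeight y k * (((k i : ℝ) - n * y i) * ((k j : ℝ) - n * y j))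
      = n * (y i * ((if i = j then 1 else 0) - y j)) := by
  induction n with
  | zero => simp [multiIdx_zero]
  | succ n ih =>
    rw [sum_rec y (fun k => ((k i : ℝ) - ((n+1 : ℕ) : ℝ) * y i) * ((k j : ℝ) - ((n+1 : ℕ) : ℝ) * y j))]
    simp_rw [cen_step]
    have : ∀ k : Fin d → ℕ, ∑ l, y l * (((k i : ℝ) - n * y i + ((if l = i then 1 else 0) - y i))
        * ((k j : ℝ) - n * y j + ((if l = j then 1 else 0) - y j)))
        = ((k i : ℝ) - n * y i) * ((k j : ℝ) - n * y j) + y i * ((if i = j then 1 else 0) - y j) := by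
      intro k
      by_cases h : i = j
      · subst h
        rw [sum_ind y hy i (fun t => ((k i : ℝ) - n * y i + (t - y i)) * ((k i : ℝ) - n * y i + (t - y i)))]
        simp; ring
      · have : ∀ l, y l * (((k i : ℝ) - n * y i + ((if l = i then 1 else 0) - y i))
          * ((k j : ℝ) - n * y j + ((if l = j then 1 else 0) - y j)))
          = (if l = i then y l * ((k j : ℝ) - n * y j - y j) else 0)
          + (if l = j then y l * ((k i : ℝ) - n * y i - y i) else 0)
          + y l * (((k i : ℝ) - n * y i - y i) * ((k j : ℝ) - n * y j - y j)) := by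
          intro l
          by_cases h1 : l = i
          · subst h1; simp [h]; ring
          · by_cases h2 : l = j
            · subst h2; simp [h1]; ring
            · simp [h1, h2]; left; ring
        simp_rw [this, Finset.sum_add_distrib, ← Finset.sum_mul, hy]
        simp [h]; ring
    simp_rw [this, mul_add, Finset.sum_add_distrib, ← Finset.sum_mul, mom0 y hy, ih]
    push_cast; ring

theorem mom4 {d : ℕ} (y : Fin d → ℝ) (hy0 : ∀ i, 0 ≤ y i) (hy : ∑ i, y i = 1) (i : Fin d) (n : ℕ) :
    ∑ k ∈ multiIdx d n, mWeight y k * ((k i : ℝ) - n * y i) ^ 4 ≤ 3 * (n : ℝ) ^ 2 := by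
  have hy1 : y i ≤ 1 := by
    rw [← hy]; exact Finset.single_le_sum (fun j _ => hy0 j) (Finset.mem_univ i)
  have h0 := hy0 i
  induction n with
  | zero => simp [multiIdx_zero]
  | succ n ih =>
    rw [sum_rec y (fun k => ((k i : ℝ) - ((n+1 : ℕ) : ℝ) * y i) ^ 4)]
    simp_rw [cen_step]
    have : ∀ k : Fin d → ℕ, mWeight y k * ∑ l, y l * ((k i : ℝ) - n * y i + ((if l = i then 1 else 0) - y i)) ^ 4
        = mWeight y k * ((k i : ℝ) - n * y i) ^ 4
         + (mWeight y k * (((k i : ℝ) - n * y i) * ((k i : ℝ) - n * y i))) * (6 * (y i * (1 - y i)))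
         + (mWeight y k * ((k i : ℝ) - n * y i)) * (4 * (y i * (1 - y i)^3 - (1 - y i) * (y i)^3))
         + mWeight y k * (y i * (1 - y i)^4 + (1 - y i) * (y i)^4) := by
      intro k
      rw [sum_ind y hy i (fun t => ((k i : ℝ) - n * y i + (t - y i)) ^ 4)]
      ring
    simp_rw [this, Finset.sum_add_distrib, ← Finset.sum_mul, mom0 y hy, mom1 y hy, mom2 y hy]
    have hs : y i * (1 - y i) ≤ 1 := by nlinarith
    have hs0 : 0 ≤ y i * (1 - y i) := mul_nonneg h0 (by linarith)
    have hs2 : (y i * (1 - y i)) * (y i * (1 - y i)) ≤ 1 := by nlinarith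
    have h4 : y i * (1 - y i)^4 + (1 - y i) * (y i)^4 ≤ 1 := by
      have a1 : (1 - y i)^4 ≤ 1 := pow_le_one₀ (by linarith) (by linarith)
      have a2 : (y i)^4 ≤ 1 := pow_le_one₀ (by linarith) (by linarith)
      nlinarith
    have hn : (0:ℝ) ≤ n := Nat.cast_nonneg n
    have := mul_le_mul_of_nonneg_left hs2 hn
    push_cast
    try simp only [if_true]
    nlinarith

theorem taylor_pt {d : ℕ} (f : (Fin d → ℝ) → ℝ) (U : Set (Fin d → ℝ)) (hU : IsOpen U)
    (hf : ContDiffOn ℝ 2 f U) (x z : Fin d → ℝ) (η : ℝ)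
    (hseg : ∀ t ∈ Set.Icc (0:ℝ) 1, x + t • (z - x) ∈ U)
    (hη : ∀ t ∈ Set.Icc (0:ℝ) 1,
      ‖fderiv ℝ (fderiv ℝ f) (x + t • (z - x)) - fderiv ℝ (fderiv ℝ f) x‖ ≤ η) :
    |f z - f x - fderiv ℝ f x (z - x) - 1/2 * fderiv ℝ (fderiv ℝ f) x (z - x) (z - x)|
      ≤ η * ‖z - x‖ ^ 2 := by
  set v := z - x with hv
  have hη0 : 0 ≤ η := le_trans (norm_nonneg (fderiv ℝ (fderiv ℝ f) (x + (0:ℝ) • v) - fderiv ℝ (fderiv ℝ f) x)) (hη 0 (by simp))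
  set c := fderiv ℝ (fderiv ℝ f) x v v with hc
  have hd1 : ∀ p ∈ U, HasFDerivAt f (fderiv ℝ f p) p := fun p hp =>
    (((hf.contDiffAt (hU.mem_nhds hp)).differentiableAt (by norm_num))).hasFDerivAt
  have hd2 : ∀ p ∈ U, HasFDerivAt (fderiv ℝ f) (fderiv ℝ (fderiv ℝ f) p) p := fun p hp =>
    (((hf.contDiffAt (hU.mem_nhds hp)).fderiv_right (m := 1) (by norm_num)).differentiableAt
      (by norm_num)).hasFDerivAt
  have hline : ∀ t : ℝ, HasDerivAt (fun t : ℝ => x + t • v) v t := fun t => by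
    simpa using ((hasDerivAt_id t).smul_const v).const_add x
  have e1 : ∀ t ∈ Set.Icc (0:ℝ) 1, HasDerivAt (fun t : ℝ => f (x + t • v))
      (fderiv ℝ f (x + t • v) v) t := fun t ht =>
    (hd1 _ (hseg t ht)).comp_hasDerivAt t (hline t)
  have e2 : ∀ t ∈ Set.Icc (0:ℝ) 1, HasDerivAt (fun t : ℝ => fderiv ℝ f (x + t • v) v)
      (fderiv ℝ (fderiv ℝ f) (x + t • v) v v) t := fun t ht => by
    have := (hd2 _ (hseg t ht)).comp_hasDerivAt t (hline t)
    simpa using this.clm_apply (hasDerivAt_const t v)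
  have b2 : ∀ t ∈ Set.Icc (0:ℝ) 1,
      |fderiv ℝ f (x + t • v) v - fderiv ℝ f x v - c * t| ≤ η * ‖v‖ ^ 2 := by
    have hh : ∀ t ∈ Set.Icc (0:ℝ) 1, HasDerivWithinAt
        (fun t : ℝ => fderiv ℝ f (x + t • v) v - fderiv ℝ f x v - c * t)
        (fderiv ℝ (fderiv ℝ f) (x + t • v) v v - c) (Set.Icc 0 1) t := fun t ht => by
      have := ((e2 t ht).sub_const (fderiv ℝ f x v)).sub ((hasDerivAt_id t).const_mul c)
      exact HasDerivAt.hasDerivWithinAt (HasDerivAt.congr_deriv this (by ring))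
    have hb : ∀ t ∈ Set.Ico (0:ℝ) 1, ‖fderiv ℝ (fderiv ℝ f) (x + t • v) v v - c‖ ≤ η * ‖v‖^2 := by
      intro t ht
      have h1 : fderiv ℝ (fderiv ℝ f) (x + t • v) v v - c
          = (fderiv ℝ (fderiv ℝ f) (x + t • v) - fderiv ℝ (fderiv ℝ f) x) v v := by simp [hc]
      rw [h1]
      refine (ContinuousLinearMap.le_opNorm₂ _ _ _).trans ?_
      rw [mul_assoc, ← sq]
      exact mul_le_mul_of_nonneg_right (hη t ⟨ht.1, ht.2.le⟩) (by positivity)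
    intro t ht
    have := norm_image_sub_le_of_norm_deriv_le_segment' hh hb t ht
    simp only [zero_smul, add_zero, mul_zero, sub_zero, sub_self, Real.norm_eq_abs] at this
    refine this.trans ?_
    have : 0 ≤ η * ‖v‖^2 := by positivity
    nlinarith [ht.2]
  have hh : ∀ t ∈ Set.Icc (0:ℝ) 1, HasDerivWithinAt
      (fun t : ℝ => f (x + t • v) - f x - fderiv ℝ f x v * t - 1/2 * c * t^2)
      (fderiv ℝ f (x + t • v) v - fderiv ℝ f x v - c * t) (Set.Icc 0 1) t := fun t ht => by
    have := (((e1 t ht).sub_const (f x)).sub ((hasDerivAt_id t).const_mul (fderiv ℝ f x v))).sub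
      (((hasDerivAt_id t).pow 2).const_mul (1/2 * c))
    refine HasDerivAt.hasDerivWithinAt (HasDerivAt.congr_deriv this ?_)
    simp only [id]
    norm_num
    ring
  have := norm_image_sub_le_of_norm_deriv_le_segment_01' hh (fun t ht => b2 t ⟨ht.1, ht.2.le⟩)
  simpa [hv, Real.norm_eq_abs] using this

theorem sup_norm_pow_le {d : ℕ} (v : Fin d → ℝ) (m : ℕ) (hm : Even m) (hm0 : m ≠ 0) :
    ‖v‖ ^ m ≤ ∑ i, v i ^ m := by
  have hpos : ∀ i, 0 ≤ v i ^ m := fun i => hm.pow_nonneg _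
  rcases isEmpty_or_nonempty (Fin d) with h | h
  · have : v = 0 := Subsingleton.elim _ _
    subst this
    simp [hm0]
  · obtain ⟨i, hi⟩ := Finite.exists_max (fun i => ‖v i‖)
    have : ‖v‖ ≤ ‖v i‖ := (pi_norm_le_iff_of_nonneg (norm_nonneg _)).2 hi
    calc ‖v‖^m ≤ ‖v i‖^m := by gcongr
      _ = v i ^ m := by rw [Real.norm_eq_abs, hm.pow_abs]
      _ ≤ _ := Finset.single_le_sum (f := fun i => v i ^ m) (fun j _ => hpos j) (Finset.mem_univ i)

theorem taylor_unif {d : ℕ} (f : (Fin d → ℝ) → ℝ) (U : Set (Fin d → ℝ)) (hU : IsOpen U)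
    (hf : ContDiffOn ℝ 2 f U) (hsub : stdSimplex ℝ (Fin d) ⊆ U) (ε : ℝ) (hε : 0 < ε) :
    ∃ C : ℝ, 0 ≤ C ∧ ∀ x ∈ stdSimplex ℝ (Fin d), ∀ z ∈ stdSimplex ℝ (Fin d),
    |f z - f x - fderiv ℝ f x (z - x) - 1/2 * fderiv ℝ (fderiv ℝ f) x (z - x) (z - x)|
      ≤ ε * ∑ i, (z i - x i) ^ 2 + C * ∑ i, (z i - x i) ^ 4 := by
  set K := stdSimplex ℝ (Fin d) with hK
  have hKc : IsCompact K := isCompact_stdSimplex ℝ (Fin d)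
  have hconv : Convex ℝ K := convex_stdSimplex ℝ (Fin d)
  have hcont : ContinuousOn (fderiv ℝ (fderiv ℝ f)) K := by
    intro p hp
    have := ((hf.contDiffAt (hU.mem_nhds (hsub hp))).fderiv_right (m := 1) (by norm_num)).fderiv_right
      (m := 0) (by norm_num)
    exact this.continuousAt.continuousWithinAt
  have huc : UniformContinuousOn (fderiv ℝ (fderiv ℝ f)) K := hKc.uniformContinuousOn_of_continuous hcont
  obtain ⟨δ, hδ, huc⟩ := (Metric.uniformContinuousOn_iff (β := (Fin d → ℝ) →L[ℝ] (Fin d → ℝ) →L[ℝ] ℝ)).1 huc ε hε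
  obtain ⟨M, hM⟩ := hKc.exists_bound_of_continuousOn (E := (Fin d → ℝ) →L[ℝ] (Fin d → ℝ) →L[ℝ] ℝ) hcont
  have hsegK : ∀ x ∈ K, ∀ z ∈ K, ∀ t ∈ Set.Icc (0:ℝ) 1, x + t • (z - x) ∈ K := by
    intro x hx z hz t ht
    exact hconv.add_smul_sub_mem hx hz ht
  refine ⟨2 * |M| / δ^2, by positivity, ?_⟩
  intro x hx z hz
  have hs2 : ‖z - x‖ ^ 2 ≤ ∑ i, (z i - x i) ^ 2 := sup_norm_pow_le (z - x) 2 (by decide) (by norm_num)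
  have hs4 : ‖z - x‖ ^ 4 ≤ ∑ i, (z i - x i) ^ 4 := sup_norm_pow_le (z - x) 4 (by decide) (by norm_num)
  have hS2 : 0 ≤ ∑ i, (z i - x i) ^ 2 := by positivity
  have hS4 : 0 ≤ ∑ i, (z i - x i) ^ 4 := (by positivity : (0:ℝ) ≤ ‖z - x‖ ^ 4).trans hs4
  by_cases hlt : ‖z - x‖ < δ
  · have := taylor_pt f U hU hf x z ε (fun t ht => hsub (hsegK x hx z hz t ht)) (by
      intro t ht
      have := huc _ (hsegK x hx z hz t ht) x hx (by
        rw [dist_eq_norm, add_sub_cancel_left, norm_smul, Real.norm_eq_abs, abs_of_nonneg ht.1]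
        nlinarith [norm_nonneg (z - x), ht.2])
      have h2 := dist_eq_norm (E := (Fin d → ℝ) →L[ℝ] (Fin d → ℝ) →L[ℝ] ℝ)
        (fderiv ℝ (fderiv ℝ f) (x + t • (z - x))) (fderiv ℝ (fderiv ℝ f) x)
      exact (le_of_eq h2.symm).trans this.le)
    have h3 : 0 ≤ 2 * |M| / δ^2 * ∑ i, (z i - x i) ^ 4 := mul_nonneg (by positivity) hS4
    nlinarith
  · push Not at hlt
    have := taylor_pt f U hU hf x z (2*|M|) (fun t ht => hsub (hsegK x hx z hz t ht)) (by
      intro t ht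
      have h1 := hM _ (hsegK x hx z hz t ht)
      have h2 := hM _ hx
      have := norm_sub_le (fderiv ℝ (fderiv ℝ f) (x + t • (z - x))) (fderiv ℝ (fderiv ℝ f) x)
      have := le_abs_self M
      linarith)
    have h4 : 2 * |M| * ‖z - x‖^2 ≤ 2 * |M| / δ^2 * ‖z - x‖ ^ 4 := by
      rw [div_mul_eq_mul_div, le_div_iff₀ (by positivity)]
      have : δ^2 ≤ ‖z - x‖^2 := by gcongr
      calc 2 * |M| * ‖z - x‖^2 * δ^2 ≤ 2 * |M| * ‖z - x‖^2 * ‖z - x‖^2 := by gcongr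
        _ = _ := by ring
    have h5 : 2 * |M| / δ^2 * ‖z - x‖ ^ 4 ≤ 2 * |M| / δ^2 * ∑ i, (z i - x i) ^ 4 := by gcongr
    nlinarith

theorem bern_core {d n : ℕ} (hn : 1 ≤ n) (f : (Fin d → ℝ) → ℝ) (x y : Fin d → ℝ)
    (hy : y ∈ stdSimplex ℝ (Fin d)) (β ε C : ℝ) (hε : 0 ≤ ε) (hC : 0 ≤ C)
    (hβ : ∀ i, |y i - x i| ≤ β)
    (L : (Fin d → ℝ) →L[ℝ] ℝ) (H : (Fin d → ℝ) →L[ℝ] (Fin d → ℝ) →L[ℝ] ℝ)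
    (hR : ∀ z ∈ stdSimplex ℝ (Fin d),
      |f z - f x - L (z - x) - 1/2 * H (z - x) (z - x)|
      ≤ ε * ∑ i, (z i - x i) ^ 2 + C * ∑ i, (z i - x i) ^ 4) :
    |bernsteinOp d n f y - f x - ∑ i, (y i - x i) * L (Pi.single i 1)
      - 1/2 * ∑ i, ∑ j, (y i * ((if i = j then 1 else 0) - y j) / n + (y i - x i) * (y j - x j))
        * H (Pi.single i 1) (Pi.single j 1)|
      ≤ ε * (d * (1 / n + β ^ 2)) + C * (d * (8 * (3 / (n:ℝ) ^ 2 + β ^ 4))) := by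
  have hn0 : (0:ℝ) < n := by exact_mod_cast hn
  have hy0 := hy.1
  have hy1 := hy.2
  have hyle : ∀ i, y i ≤ 1 := fun i => by
    rw [← hy1]; exact Finset.single_le_sum (fun j _ => hy0 j) (Finset.mem_univ i)
  have hL : ∀ v, L v = ∑ i, v i * L (Pi.single i 1) := by
    intro v
    conv_lhs => rw [pi_eq_sum_univ' v]
    simp [map_sum, map_smul]
  have hH : ∀ v, H v v = ∑ i, ∑ j, (v i * v j) * H (Pi.single i 1) (Pi.single j 1) := by
    intro v
    conv_lhs => rw [pi_eq_sum_univ' v]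
    simp only [map_sum, map_smul, _root_.sum_apply, _root_.smul_apply,
      smul_eq_mul, Finset.mul_sum]
    rw [Finset.sum_comm]
    refine Finset.sum_congr rfl fun i _ => Finset.sum_congr rfl fun j _ => by ring
  have hv : ∀ (k : Fin d → ℕ) i, (k i : ℝ) / n - x i = ((k i : ℝ) - n * y i) / n + (y i - x i) := by
    intro k i; field_simp; ring
  have m0 := mom0 y hy1 n
  have M1 : ∀ i, ∑ k ∈ multiIdx d n, mWeight y k * ((k i : ℝ) / n - x i) = y i - x i := by
    intro i
    have : ∀ k : Fin d → ℕ, mWeight y k * ((k i : ℝ) / n - x i)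
        = mWeight y k * ((k i : ℝ) - n * y i) * (1 / n) + mWeight y k * (y i - x i) := by
      intro k; rw [hv]; ring
    simp_rw [this, Finset.sum_add_distrib, ← Finset.sum_mul, m0, mom1 y hy1]
    ring
  have M2 : ∀ i j, ∑ k ∈ multiIdx d n, mWeight y k * (((k i : ℝ) / n - x i) * ((k j : ℝ) / n - x j))
      = y i * ((if i = j then 1 else 0) - y j) / n + (y i - x i) * (y j - x j) := by
    intro i j
    have : ∀ k : Fin d → ℕ, mWeight y k * (((k i : ℝ) / n - x i) * ((k j : ℝ) / n - x j))
        = mWeight y k * (((k i : ℝ) - n * y i) * ((k j : ℝ) - n * y j)) * (1 / n ^ 2)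
        + mWeight y k * ((k i : ℝ) - n * y i) * (1 / n * (y j - x j))
        + mWeight y k * ((k j : ℝ) - n * y j) * (1 / n * (y i - x i))
        + mWeight y k * ((y i - x i) * (y j - x j)) := by
      intro k; rw [hv, hv]; ring
    simp_rw [this, Finset.sum_add_distrib, ← Finset.sum_mul, m0, mom1 y hy1, mom2 y hy1]
    field_simp; ring
  have M2' : ∀ i, ∑ k ∈ multiIdx d n, mWeight y k * ((k i : ℝ) / n - x i) ^ 2 ≤ 1 / n + β ^ 2 := by
    intro i
    simp_rw [sq ((_ : ℝ) / n - x i), M2]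
    rw [← sq]
    have h1 : y i * ((if i = i then 1 else 0) - y i) ≤ 1 := by
      simp only [if_true]; nlinarith [hy0 i, hyle i]
    have h2 : (y i - x i) ^ 2 ≤ β ^ 2 := sq_le_sq' (abs_le.1 (hβ i)).1 (abs_le.1 (hβ i)).2
    have h3 : y i * ((if i = i then 1 else 0) - y i) / n ≤ 1 / n := by gcongr
    linarith
  have M4 : ∀ i, ∑ k ∈ multiIdx d n, mWeight y k * ((k i : ℝ) / n - x i) ^ 4
      ≤ 8 * (3 / (n:ℝ) ^ 2 + β ^ 4) := by
    intro i
    have hb4 : (y i - x i) ^ 4 ≤ β ^ 4 := by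
      rw [← Even.pow_abs (by decide : Even 4) (y i - x i)]
      exact pow_le_pow_left₀ (abs_nonneg _) (hβ i) 4
    have h8 : ∀ a b : ℝ, (a + b) ^ 4 ≤ 8 * (a ^ 4 + b ^ 4) := by
      intro a b
      nlinarith [sq_nonneg (a - b), sq_nonneg (a + b), sq_nonneg (a^2 - b^2), sq_nonneg ((a-b)^2),
        mul_nonneg (sq_nonneg (a-b)) (sq_nonneg (a+b)), sq_nonneg (a*b)]
    calc _ ≤ ∑ k ∈ multiIdx d n, (mWeight y k * ((k i : ℝ) - n * y i) ^ 4 * (8 / n ^ 4)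
              + mWeight y k * (8 * β ^ 4)) := by
          refine Finset.sum_le_sum fun k _ => ?_
          have hw := mW_nonneg y hy0 k
          have : ((k i : ℝ) / n - x i) ^ 4 ≤ ((k i : ℝ) - n * y i) ^ 4 * (8 / n ^ 4) + 8 * β ^ 4 := by
            rw [hv]
            refine (h8 _ _).trans ?_
            rw [div_pow]
            have : 8 * (((k i : ℝ) - n * y i) ^ 4 / n ^ 4) = ((k i : ℝ) - n * y i) ^ 4 * (8 / n ^ 4) := by
              ring
            linarith
          calc _ ≤ mWeight y k * (((k i : ℝ) - n * y i) ^ 4 * (8 / n ^ 4) + 8 * β ^ 4) :=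
                mul_le_mul_of_nonneg_left this hw
            _ = _ := by ring
      _ ≤ 3 * (n:ℝ) ^ 2 * (8 / n ^ 4) + 8 * β ^ 4 := by
          rw [Finset.sum_add_distrib, ← Finset.sum_mul, ← Finset.sum_mul, m0, one_mul]
          have := mom4 y hy0 hy1 i n
          gcongr
      _ = _ := by field_simp
  set R : (Fin d → ℕ) → ℝ := fun k => f (fun i => (k i : ℝ) / n) - f x
    - L ((fun i => (k i : ℝ) / n) - x) - 1/2 * H ((fun i => (k i : ℝ) / n) - x) ((fun i => (k i : ℝ) / n) - x)
    with hRdef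
  have key : bernsteinOp d n f y - f x - ∑ i, (y i - x i) * L (Pi.single i 1)
      - 1/2 * ∑ i, ∑ j, (y i * ((if i = j then 1 else 0) - y j) / n + (y i - x i) * (y j - x j))
        * H (Pi.single i 1) (Pi.single j 1) = ∑ k ∈ multiIdx d n, mWeight y k * R k := by
    have e0 : f x = ∑ k ∈ multiIdx d n, mWeight y k * f x := by rw [← Finset.sum_mul, m0, one_mul]
    have e1 : ∑ i, (y i - x i) * L (Pi.single i 1)
        = ∑ k ∈ multiIdx d n, mWeight y k * L ((fun i => (k i : ℝ) / n) - x) := by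
      simp_rw [← M1, hL ((fun i => _) - x), Finset.mul_sum, Finset.sum_mul]
      rw [Finset.sum_comm]
      refine Finset.sum_congr rfl fun i _ => Finset.sum_congr rfl fun j _ => ?_
      simp only [Pi.sub_apply]; ring
    have e2 : ∑ i, ∑ j, (y i * ((if i = j then 1 else 0) - y j) / n + (y i - x i) * (y j - x j))
        * H (Pi.single i 1) (Pi.single j 1)
        = ∑ k ∈ multiIdx d n, mWeight y k * H ((fun i => (k i : ℝ) / n) - x) ((fun i => (k i : ℝ) / n) - x) := by
      simp_rw [← M2, hH ((fun i => _) - x), Finset.mul_sum, Finset.sum_mul]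
      symm
      rw [Finset.sum_comm]
      refine Finset.sum_congr rfl fun i _ => ?_
      rw [Finset.sum_comm]
      refine Finset.sum_congr rfl fun j _ => Finset.sum_congr rfl fun k _ => ?_
      simp only [Pi.sub_apply]; ring
    rw [e1, e2]
    nth_rewrite 1 [e0]
    unfold bernsteinOp
    rw [Finset.mul_sum, ← Finset.sum_sub_distrib, ← Finset.sum_sub_distrib, ← Finset.sum_sub_distrib]
    refine Finset.sum_congr rfl fun k _ => ?_
    simp only [hRdef]; ring
  rw [key]
  have hmem : ∀ k ∈ multiIdx d n, (fun i => (k i : ℝ) / n) ∈ stdSimplex ℝ (Fin d) := by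
    intro k hk
    rw [mem_multiIdx] at hk
    refine ⟨fun i => by positivity, ?_⟩
    rw [← Finset.sum_div]
    have : ∑ i, (k i : ℝ) = n := by exact_mod_cast hk
    rw [this, div_self hn0.ne']
  calc _ ≤ ∑ k ∈ multiIdx d n, |mWeight y k * R k| := Finset.abs_sum_le_sum_abs _ _
    _ ≤ ∑ k ∈ multiIdx d n, mWeight y k * (ε * ∑ i, ((k i : ℝ) / n - x i) ^ 2
          + C * ∑ i, ((k i : ℝ) / n - x i) ^ 4) := by
        refine Finset.sum_le_sum fun k hk => ?_
        have hw := mW_nonneg y hy0 k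
        rw [abs_mul, abs_of_nonneg hw]
        exact mul_le_mul_of_nonneg_left (hR _ (hmem k hk)) hw
    _ = ε * ∑ i, ∑ k ∈ multiIdx d n, mWeight y k * ((k i : ℝ) / n - x i) ^ 2
        + C * ∑ i, ∑ k ∈ multiIdx d n, mWeight y k * ((k i : ℝ) / n - x i) ^ 4 := by
        rw [Finset.sum_comm, Finset.sum_comm (s := Finset.univ (α := Fin d)), Finset.mul_sum, Finset.mul_sum,
          ← Finset.sum_add_distrib]
        refine Finset.sum_congr rfl fun k _ => ?_
        rw [← Finset.mul_sum, ← Finset.mul_sum]; ring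
    _ ≤ _ := by
        have a2 : ∑ i, ∑ k ∈ multiIdx d n, mWeight y k * ((k i : ℝ) / n - x i) ^ 2
            ≤ d * (1 / n + β ^ 2) := by
          refine (Finset.sum_le_sum fun i _ => M2' i).trans ?_
          rw [Finset.sum_const, Finset.card_univ, Fintype.card_fin, nsmul_eq_mul]
        have a4 : ∑ i, ∑ k ∈ multiIdx d n, mWeight y k * ((k i : ℝ) / n - x i) ^ 4
            ≤ d * (8 * (3 / (n:ℝ) ^ 2 + β ^ 4)) := by
          refine (Finset.sum_le_sum fun i _ => M4 i).trans ?_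
          rw [Finset.sum_const, Finset.card_univ, Fintype.card_fin, nsmul_eq_mul]
        gcongr

theorem pd2_eq {d : ℕ} (f : (Fin d → ℝ) → ℝ) (U : Set (Fin d → ℝ)) (hU : IsOpen U)
    (hf : ContDiffOn ℝ 2 f U) (x : Fin d → ℝ) (hx : x ∈ U) (i j : Fin d) :
    pd2 i j f x = fderiv ℝ (fderiv ℝ f) x (Pi.single i 1) (Pi.single j 1) := by
  have hd : HasFDerivAt (fderiv ℝ f) (fderiv ℝ (fderiv ℝ f) x) x :=
    (((hf.contDiffAt (hU.mem_nhds hx)).fderiv_right (m := 1) (by norm_num)).differentiableAt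
      (by norm_num)).hasFDerivAt
  have h := hd.clm_apply (hasFDerivAt_const (Pi.single j (1:ℝ) : Fin d → ℝ) x)
  unfold pd2 pd
  rw [HasFDerivAt.fderiv h]
  simp

theorem coef_bounds {d : ℕ} (f : (Fin d → ℝ) → ℝ) (U : Set (Fin d → ℝ)) (hU : IsOpen U)
    (hf : ContDiffOn ℝ 2 f U) (hsub : stdSimplex ℝ (Fin d) ⊆ U) :
    ∃ P : ℝ, 0 ≤ P ∧ ∀ x ∈ stdSimplex ℝ (Fin d), (∀ i, |fderiv ℝ f x (Pi.single i 1)| ≤ P) ∧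
      ∀ i j, |fderiv ℝ (fderiv ℝ f) x (Pi.single i 1) (Pi.single j 1)| ≤ P := by
  have hKc : IsCompact (stdSimplex ℝ (Fin d)) := isCompact_stdSimplex ℝ (Fin d)
  have hc2 : ContinuousOn (fderiv ℝ (fderiv ℝ f)) (stdSimplex ℝ (Fin d)) := by
    intro p hp
    have := ((hf.contDiffAt (hU.mem_nhds (hsub hp))).fderiv_right (m := 1) (by norm_num)).fderiv_right
      (m := 0) (by norm_num)
    exact this.continuousAt.continuousWithinAt
  have hc1 : ContinuousOn (fderiv ℝ f) (stdSimplex ℝ (Fin d)) := by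
    intro p hp
    have := ((hf.contDiffAt (hU.mem_nhds (hsub hp))).fderiv_right (m := 1) (by norm_num))
    exact this.continuousAt.continuousWithinAt
  obtain ⟨M1, h1⟩ := hKc.exists_bound_of_continuousOn hc1
  obtain ⟨M2, h2⟩ := hKc.exists_bound_of_continuousOn (E := (Fin d → ℝ) →L[ℝ] (Fin d → ℝ) →L[ℝ] ℝ) hc2
  have hs : ∀ i : Fin d, ‖(Pi.single i 1 : Fin d → ℝ)‖ = 1 := by
    intro i; rw [Pi.norm_single]; simp
  refine ⟨|M1| + |M2|, by positivity, fun x hx => ⟨fun i => ?_, fun i j => ?_⟩⟩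
  · have := (fderiv ℝ f x).le_opNorm (Pi.single i 1)
    rw [hs, mul_one, Real.norm_eq_abs] at this
    linarith [h1 x hx, le_abs_self M1, abs_nonneg M2]
  · have := (fderiv ℝ (fderiv ℝ f) x).le_opNorm₂ (Pi.single i 1) (Pi.single j 1)
    rw [hs, hs, mul_one, mul_one, Real.norm_eq_abs] at this
    linarith [h2 x hx, le_abs_self M2, abs_nonneg M1]

theorem sum_abs_bound {d : ℕ} (a c : Fin d → ℝ) (A P : ℝ) (ha : ∀ i, |a i| ≤ A) (hc : ∀ i, |c i| ≤ P) :
    |∑ i, a i * c i| ≤ d * (A * P) := by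
  calc _ ≤ ∑ i, |a i * c i| := Finset.abs_sum_le_sum_abs _ _
    _ ≤ ∑ i : Fin d, A * P := Finset.sum_le_sum fun i _ => by
        rw [abs_mul]
        exact mul_le_mul (ha i) (hc i) (abs_nonneg _) ((abs_nonneg _).trans (ha i))
    _ = _ := by rw [Finset.sum_const, Finset.card_univ, Fintype.card_fin, nsmul_eq_mul]

theorem simplex_le_one {d : ℕ} (x : Fin d → ℝ) (hx : x ∈ stdSimplex ℝ (Fin d)) (i : Fin d) :
    |x i| ≤ 1 := by
  rw [abs_of_nonneg (hx.1 i), ← hx.2]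
  exact Finset.single_le_sum (fun j _ => hx.1 j) (Finset.mem_univ i)

theorem step_bound {d n : ℕ} (hn : 1 ≤ n) (f : (Fin d → ℝ) → ℝ) (x y c : Fin d → ℝ)
    (hx : x ∈ stdSimplex ℝ (Fin d)) (hy : y ∈ stdSimplex ℝ (Fin d)) (β ε C P κ : ℝ)
    (hε : 0 ≤ ε) (hC : 0 ≤ C)
    (hβ : ∀ i, |y i - x i| ≤ β)
    (hc : ∀ i, |n * (y i - x i) - c i| ≤ κ)
    (L : (Fin d → ℝ) →L[ℝ] ℝ) (H : (Fin d → ℝ) →L[ℝ] (Fin d → ℝ) →L[ℝ] ℝ)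
    (hLP : ∀ i, |L (Pi.single i 1)| ≤ P) (hHP : ∀ i j, |H (Pi.single i 1) (Pi.single j 1)| ≤ P)
    (hR : ∀ z ∈ stdSimplex ℝ (Fin d),
      |f z - f x - L (z - x) - 1/2 * H (z - x) (z - x)|
      ≤ ε * ∑ i, (z i - x i) ^ 2 + C * ∑ i, (z i - x i) ^ 4) :
    |(n : ℝ) * (bernsteinOp d n f y - f x)
      - ((1 / 2) * (∑ i, ∑ j, x i * ((if i = j then 1 else 0) - x j) * H (Pi.single i 1) (Pi.single j 1))
        + ∑ i, c i * L (Pi.single i 1))|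
      ≤ n * (ε * (d * (1 / n + β ^ 2)) + C * (d * (8 * (3 / (n:ℝ) ^ 2 + β ^ 4))))
        + d * (κ * P) + 1 / 2 * (d * (d * ((3 * β + n * β ^ 2) * P))) := by
  have hn0 : (0:ℝ) < n := by exact_mod_cast hn
  have core := bern_core hn f x y hy β ε C hε hC hβ L H hR
  have t1 := sum_abs_bound (fun i => n * (y i - x i) - c i) (fun i => L (Pi.single i 1)) κ P hc hLP
  have hcoef : ∀ i j, |y i * ((if i = j then 1 else 0) - y j) + n * ((y i - x i) * (y j - x j))
      - x i * ((if i = j then 1 else 0) - x j)| ≤ 3 * β + n * β ^ 2 := by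
    intro i j
    have hβ0 : 0 ≤ β := (abs_nonneg _).trans (hβ i)
    have e : y i * ((if i = j then 1 else 0) - y j) + n * ((y i - x i) * (y j - x j))
      - x i * ((if i = j then 1 else 0) - x j)
      = (y i - x i) * (if i = j then 1 else 0) + (-((y i - x i) * y j)) + (-(x i * (y j - x j)))
        + n * ((y i - x i) * (y j - x j)) := by ring
    rw [e]
    have a1 : |(y i - x i) * (if i = j then 1 else 0)| ≤ β := by
      split_ifs
      · simpa using hβ i
      · simpa using hβ0
    have a2 : |-((y i - x i) * y j)| ≤ β := by
      rw [abs_neg, abs_mul]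
      exact (mul_le_mul (hβ i) (simplex_le_one y hy j) (abs_nonneg _) hβ0).trans (by simp)
    have a3 : |-(x i * (y j - x j))| ≤ β := by
      rw [abs_neg, abs_mul]
      exact (mul_le_mul (simplex_le_one x hx i) (hβ j) (abs_nonneg _) zero_le_one).trans (by simp)
    have a4 : |n * ((y i - x i) * (y j - x j))| ≤ n * β ^ 2 := by
      rw [abs_mul, abs_of_pos hn0, abs_mul, sq]
      exact mul_le_mul_of_nonneg_left (mul_le_mul (hβ i) (hβ j) (abs_nonneg _) hβ0) hn0.le
    refine (abs_add_le _ _).trans ?_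
    have := abs_add_three ((y i - x i) * (if i = j then 1 else 0)) (-((y i - x i) * y j)) (-(x i * (y j - x j)))
    linarith
  have t2 : |∑ i, ∑ j, (y i * ((if i = j then 1 else 0) - y j) + n * ((y i - x i) * (y j - x j))
      - x i * ((if i = j then 1 else 0) - x j)) * H (Pi.single i 1) (Pi.single j 1)|
      ≤ d * (d * ((3 * β + n * β ^ 2) * P)) := by
    have := sum_abs_bound (fun i => ∑ j, (y i * ((if i = j then 1 else 0) - y j) + n * ((y i - x i) * (y j - x j))
      - x i * ((if i = j then 1 else 0) - x j)) * H (Pi.single i 1) (Pi.single j 1)) (fun _ => 1)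
      (d * ((3 * β + n * β ^ 2) * P)) 1
      (fun i => sum_abs_bound _ _ _ _ (hcoef i) (hHP i)) (by simp)
    simpa using this
  set T1 := ∑ i, (n * (y i - x i) - c i) * L (Pi.single i 1) with hT1
  set T2 := ∑ i, ∑ j, (y i * ((if i = j then 1 else 0) - y j) + n * ((y i - x i) * (y j - x j))
      - x i * ((if i = j then 1 else 0) - x j)) * H (Pi.single i 1) (Pi.single j 1) with hT2
  set T0 := bernsteinOp d n f y - f x - ∑ i, (y i - x i) * L (Pi.single i 1)
      - 1/2 * ∑ i, ∑ j, (y i * ((if i = j then 1 else 0) - y j) / n + (y i - x i) * (y j - x j))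
        * H (Pi.single i 1) (Pi.single j 1) with hT0
  have s1 : T1 = n * (∑ i, (y i - x i) * L (Pi.single i 1)) - ∑ i, c i * L (Pi.single i 1) := by
    rw [hT1, Finset.mul_sum, ← Finset.sum_sub_distrib]
    exact Finset.sum_congr rfl fun i _ => by ring
  have s2 : T2 = n * (∑ i, ∑ j, (y i * ((if i = j then 1 else 0) - y j) / n + (y i - x i) * (y j - x j))
        * H (Pi.single i 1) (Pi.single j 1))
        - ∑ i, ∑ j, x i * ((if i = j then 1 else 0) - x j) * H (Pi.single i 1) (Pi.single j 1) := by
    rw [hT2, Finset.mul_sum, ← Finset.sum_sub_distrib]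
    refine Finset.sum_congr rfl fun i _ => ?_
    rw [Finset.mul_sum, ← Finset.sum_sub_distrib]
    refine Finset.sum_congr rfl fun j _ => ?_
    have : y i * ((if i = j then 1 else 0) - y j) = n * (y i * ((if i = j then 1 else 0) - y j) / n) := by
      field_simp
    rw [this]
    field_simp
  have key : (n : ℝ) * (bernsteinOp d n f y - f x)
      - ((1 / 2) * (∑ i, ∑ j, x i * ((if i = j then 1 else 0) - x j) * H (Pi.single i 1) (Pi.single j 1))
        + ∑ i, c i * L (Pi.single i 1)) = n * T0 + T1 + 1/2 * T2 := by
    rw [s1, s2, hT0]; ring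
  rw [key]
  refine (abs_add_three _ _ _).trans ?_
  have u0 : |n * T0| ≤ n * (ε * (d * (1 / n + β ^ 2)) + C * (d * (8 * (3 / (n:ℝ) ^ 2 + β ^ 4)))) := by
    rw [abs_mul, abs_of_pos hn0]
    exact mul_le_mul_of_nonneg_left core hn0.le
  have u2 : |1/2 * T2| ≤ 1 / 2 * (d * (d * ((3 * β + n * β ^ 2) * P))) := by
    rw [abs_mul, abs_of_pos (by norm_num : (0:ℝ) < 1/2)]
    exact mul_le_mul_of_nonneg_left t2 (by norm_num)
  linarith


/-- Voronovskaya-type theorem with mutation: under (Q1), for `f`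
twice continuously differentiable on an open neighborhood of the simplex,
`lim_{n→∞} max_{x ∈ Δ_{d−1}} |n(B_{d,n}^{(q_n)} f(x) − f(x)) − 𝒜_d^{(q)} f(x)| = 0`,
where `B_{d,n}^{(q_n)} f(x) = B_{d,n} f(x^{(q_n)})` and
`x_i^{(q_n)} = x_i + ∑_j q_{ji}^{(n)} x_j`. -/
theorem voronovskaya_bernstein_mutation (d : ℕ) (hd : 2 ≤ d)
    (q : ℕ → Fin d → Fin d → ℝ)
    (hqpos : ∀ n, 1 ≤ n → ∀ i j, i ≠ j → 0 < q n i j)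
    (hqdiag : ∀ n, 1 ≤ n → ∀ i, q n i i = -∑ j ∈ Finset.univ.erase i, q n i j)
    (hqsimplex : ∀ n, 1 ≤ n → ∀ x ∈ stdSimplex ℝ (Fin d),
      (fun i => x i + ∑ j, q n j i * x j) ∈ stdSimplex ℝ (Fin d))
    -- Assumption (Q1):
    (Q : Fin d → Fin d → ℝ)
    (hQpos : ∀ i j, i ≠ j → 0 < Q i j)
    (hQdiag : ∀ i, Q i i = -∑ j ∈ Finset.univ.erase i, Q i j)
    (C₀ γ : ℝ) (hC₀ : 0 < C₀) (hγ : 1 < γ)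
    (hQ1 : ∀ n : ℕ, 1 ≤ n → ∀ i j, |q n i j - Q i j / n| ≤ C₀ * (n : ℝ) ^ (-γ))
    (f : (Fin d → ℝ) → ℝ)
    (U : Set (Fin d → ℝ)) (hU : IsOpen U) (hsub : stdSimplex ℝ (Fin d) ⊆ U)
    (hf : ContDiffOn ℝ 2 f U) :
    Tendsto (fun n : ℕ => ⨆ x ∈ stdSimplex ℝ (Fin d),
        |(n : ℝ) * (bernsteinOp d n f (fun i => x i + ∑ j, q n j i * x j) - f x)
          - Adq d Q f x|)
      atTop (nhds 0) := by
  obtain ⟨P, hP0, hP⟩ := coef_bounds f U hU hf hsub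
  set B : ℝ := ∑ i, ∑ j, (|Q j i| + C₀) with hB
  rw [Metric.tendsto_atTop']
  intro e he
  set ε : ℝ := e / (2 * (d + 1)) with hεdef
  have hε : 0 < ε := by positivity
  have hεd : ε * d < e := by
    rw [hεdef, div_mul_eq_mul_div, div_lt_iff₀ (by positivity)]
    have : (0:ℝ) ≤ d := Nat.cast_nonneg d
    nlinarith
  obtain ⟨C, hC, hT⟩ := taylor_unif f U hU hf hsub ε hε
  set g : ℕ → ℝ := fun n => ε * d * (1 + B ^ 2 * (1 / (n:ℝ))) + 8 * C * d * (3 * (1 / (n:ℝ)) + B ^ 4 * (1 / (n:ℝ)) ^ 3)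
    + d * (d * (C₀ * (n:ℝ) ^ (-(γ - 1))) * P)
    + 1 / 2 * (d * (d * ((3 * (B * (1 / (n:ℝ))) + B ^ 2 * (1 / (n:ℝ))) * P))) with hg
  have hlim : Tendsto g atTop (nhds (ε * d)) := by
    have u : Tendsto (fun n : ℕ => 1 / (n:ℝ)) atTop (nhds 0) := tendsto_one_div_atTop_nhds_zero_nat
    have w : Tendsto (fun n : ℕ => (n:ℝ) ^ (-(γ - 1))) atTop (nhds 0) :=
      (tendsto_rpow_neg_atTop (by linarith : 0 < γ - 1)).comp tendsto_natCast_atTop_atTop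
    have hcont : Continuous (fun p : ℝ × ℝ => ε * d * (1 + B ^ 2 * p.1)
      + 8 * C * d * (3 * p.1 + B ^ 4 * p.1 ^ 3)
      + d * (d * (C₀ * p.2) * P)
      + 1 / 2 * (d * (d * ((3 * (B * p.1) + B ^ 2 * p.1) * P)))) := by fun_prop
    have := (hcont.tendsto (0, 0)).comp (u.prodMk_nhds w)
    simpa [hg, Function.comp_def] using this
  obtain ⟨N, hN⟩ := eventually_atTop.1 (hlim.eventually (gt_mem_nhds hεd))
  refine ⟨N + 1, fun n hn => ?_⟩
  have hn1 : 1 ≤ n := by omega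
  have hn0 : (0:ℝ) < n := by exact_mod_cast hn1
  have hn1' : (1:ℝ) ≤ n := by exact_mod_cast hn1
  have hgn := hN n (by omega)
  have hpt : ∀ x ∈ stdSimplex ℝ (Fin d),
      |(n : ℝ) * (bernsteinOp d n f (fun i => x i + ∑ j, q n j i * x j) - f x)
          - Adq d Q f x| ≤ g n := by
    intro x hx
    have hrp : (n:ℝ) ^ (-γ) ≤ 1 / n := by
      rw [one_div, ← Real.rpow_neg_one]
      exact Real.rpow_le_rpow_of_exponent_le hn1' (by linarith)
    have hrp2 : (n:ℝ) * (n:ℝ) ^ (-γ) = (n:ℝ) ^ (-(γ - 1)) := by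
      rw [show -(γ - 1) = 1 + -γ by ring, Real.rpow_add hn0, Real.rpow_one]
    have hβ : ∀ i, |(x i + ∑ j, q n j i * x j) - x i| ≤ B / n := by
      intro i
      rw [add_sub_cancel_left]
      calc _ ≤ ∑ j, |q n j i * x j| := Finset.abs_sum_le_sum_abs _ _
        _ ≤ ∑ j, (|Q j i| + C₀) / n := by
          refine Finset.sum_le_sum fun j _ => ?_
          rw [abs_mul]
          have h1 : |q n j i| ≤ (|Q j i| + C₀) / n := by
            have := hQ1 n hn1 j i
            have h2 : |q n j i| ≤ |q n j i - Q j i / n| + |Q j i / n| := by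
              simpa using abs_add_le (q n j i - Q j i / n) (Q j i / n)
            rw [abs_div, abs_of_pos hn0] at h2
            have h3 : C₀ * (n:ℝ) ^ (-γ) ≤ C₀ * (1 / n) := by gcongr
            have h4 : (|Q j i| + C₀) / n = |Q j i| / n + C₀ * (1 / n) := by ring
            linarith
          exact (mul_le_mul h1 (simplex_le_one x hx j) (abs_nonneg _) (by positivity)).trans (by simp)
        _ = (∑ j, (|Q j i| + C₀)) / n := by rw [Finset.sum_div]
        _ ≤ B / n := by
          have : ∑ j, (|Q j i| + C₀) ≤ B :=
            Finset.single_le_sum (f := fun i => ∑ j, (|Q j i| + C₀)) (fun i _ => by positivity)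
              (Finset.mem_univ i)
          gcongr
    have hc : ∀ i, |n * ((x i + ∑ j, q n j i * x j) - x i) - ∑ j, Q j i * x j|
        ≤ d * (C₀ * (n:ℝ) ^ (-(γ - 1))) := by
      intro i
      have e1 : n * ((x i + ∑ j, q n j i * x j) - x i) - ∑ j, Q j i * x j
          = ∑ j, (n * (q n j i - Q j i / n)) * x j := by
        rw [add_sub_cancel_left, Finset.mul_sum, ← Finset.sum_sub_distrib]
        refine Finset.sum_congr rfl fun j _ => ?_
        field_simp
      rw [e1]
      have := sum_abs_bound (fun j => n * (q n j i - Q j i / n)) x (C₀ * (n:ℝ) ^ (-(γ - 1))) 1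
        (fun j => by
          rw [abs_mul, abs_of_pos hn0, ← hrp2]
          have := mul_le_mul_of_nonneg_left (hQ1 n hn1 j i) hn0.le
          linarith) (simplex_le_one x hx)
      simpa using this
    have := step_bound hn1 f x (fun i => x i + ∑ j, q n j i * x j) (fun i => ∑ j, Q j i * x j) hx
      (hqsimplex n hn1 x hx) (B / n) ε C P (d * (C₀ * (n:ℝ) ^ (-(γ - 1)))) hε.le hC hβ hc
      (fderiv ℝ f x) (fderiv ℝ (fderiv ℝ f) x) (hP x hx).1 (hP x hx).2 (hT x hx)
    have hA : Adq d Q f x = ((1 / 2) * (∑ i, ∑ j, x i * ((if i = j then 1 else 0) - x j)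
        * fderiv ℝ (fderiv ℝ f) x (Pi.single i 1) (Pi.single j 1))
        + ∑ i, (∑ j, Q j i * x j) * fderiv ℝ f x (Pi.single i 1)) := by
      unfold Adq
      simp_rw [pd2_eq f U hU hf x (hsub hx)]
      rfl
    rw [hA]
    refine this.trans (le_of_eq ?_)
    simp only [hg]
    field_simp
  have h0 : 0 ≤ g n := by
    have : Nonempty (Fin d) := ⟨⟨0, by omega⟩⟩
    exact (abs_nonneg _).trans (hpt _ (single_mem_stdSimplex ℝ (⟨0, by omega⟩ : Fin d)))
  rw [Real.dist_eq, sub_zero, abs_of_nonneg]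
  · refine lt_of_le_of_lt ?_ hgn
    exact Real.iSup_le (fun x => Real.iSup_le (fun hx => hpt x hx) h0) h0
  · exact Real.iSup_nonneg fun x => Real.iSup_nonneg fun _ => abs_nonneg _
end
end
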